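/- arXiv:1607.00997 — 2 statements merged into one kernel-verified Lean document; each statement's English description precedes it below -/
import Mathlib

section
/- Let k be a field with char k ≥ 23. Then there exists a unique matrix F ∈ M₈(k) such that F ∈ V, ρ̌(t) F ρ̌(t)⁻¹ = t⁻¹·F for all t ∈ kˣ, and [E, F] = diag(6, 4, −4, −6, 2, 0, 0, −2). -/
open Matrix

noncomputable section

/-- The 8×8 matrix `Ψ`, block diagonal with two anti-diagonal 4×4 blocks. -/
def Psi (k : Type*) [Field k] : Matrix (Fin 8) (Fin 8) k :=
  !![0,0,0,1,0,0,0,0;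
     0,0,1,0,0,0,0,0;
     0,1,0,0,0,0,0,0;
     1,0,0,0,0,0,0,0;
     0,0,0,0,0,0,0,1;
     0,0,0,0,0,0,1,0;
     0,0,0,0,0,1,0,0;
     0,0,0,0,1,0,0,0]

/-- The matrix `s = diag(1,−1,−1,1,1,−1,−1,1)`. -/
def sMat (k : Type*) [Field k] : Matrix (Fin 8) (Fin 8) k :=
  Matrix.diagonal ![1,-1,-1,1,1,-1,-1,1]

/-- `so₈(k) = {v : vᵀΨ = −Ψv}`. -/
def so8Set (k : Type*) [Field k] : Set (Matrix (Fin 8) (Fin 8) k) :=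
  {v | vᵀ * Psi k = -(Psi k * v)}

/-- The `(−1)`-eigenspace `V` of `θ(v) = svs` on `so₈(k)`. -/
def VSet (k : Type*) [Field k] : Set (Matrix (Fin 8) (Fin 8) k) :=
  {v | vᵀ * Psi k = -(Psi k * v) ∧ sMat k * v * sMat k = -v}

/-- `so₈(k)` as a `k`-submodule of the 8×8 matrices. -/
def so8Sub (k : Type*) [Field k] : Submodule k (Matrix (Fin 8) (Fin 8) k) where
  carrier := so8Set k
  add_mem' := by
    intro a b ha hb
    simp only [so8Set, Set.mem_setOf_eq] at *
    rw [Matrix.transpose_add, Matrix.add_mul, ha, hb, Matrix.mul_add, neg_add]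
  zero_mem' := by simp [so8Set]
  smul_mem' := by
    intro c a ha
    simp only [so8Set, Set.mem_setOf_eq] at *
    rw [Matrix.transpose_smul, Matrix.smul_mul, ha, Matrix.mul_smul, smul_neg]

/-- `V` as a `k`-submodule of the 8×8 matrices. -/
def VSubm (k : Type*) [Field k] : Submodule k (Matrix (Fin 8) (Fin 8) k) where
  carrier := VSet k
  add_mem' := by
    intro a b ha hb
    obtain ⟨ha1, ha2⟩ := ha
    obtain ⟨hb1, hb2⟩ := hb
    constructor
    · rw [Matrix.transpose_add, Matrix.add_mul, ha1, hb1, Matrix.mul_add, neg_add]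
    · rw [Matrix.mul_add, Matrix.add_mul, ha2, hb2, neg_add]
  zero_mem' := by constructor <;> simp
  smul_mem' := by
    intro c a ha
    obtain ⟨ha1, ha2⟩ := ha
    constructor
    · rw [Matrix.transpose_smul, Matrix.smul_mul, ha1, Matrix.mul_smul, smul_neg]
    · rw [Matrix.mul_smul, Matrix.smul_mul, ha2, smul_neg]

/-- The subspace of matrices commuting with a fixed matrix `F`. -/
def commSub (k : Type*) [Field k] (F : Matrix (Fin 8) (Fin 8) k) :
    Submodule k (Matrix (Fin 8) (Fin 8) k) where
  carrier := {x | x * F = F * x}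
  add_mem' := by
    intro a b ha hb
    simp only [Set.mem_setOf_eq] at *
    rw [Matrix.add_mul, Matrix.mul_add, ha, hb]
  zero_mem' := by simp
  smul_mem' := by
    intro c a ha
    simp only [Set.mem_setOf_eq] at *
    rw [Matrix.smul_mul, Matrix.mul_smul, ha]

/-- The regular nilpotent element `E`. -/
def Emat (k : Type*) [Field k] : Matrix (Fin 8) (Fin 8) k :=
  !![0,1,0,0,0,0,0,0;
     0,0,0,0,1,0,0,0;
     0,0,0,-1,0,0,0,0;
     0,0,0,0,0,0,0,0;
     0,0,0,0,0,1,1,0;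
     0,0,0,0,0,0,0,-1;
     0,0,0,0,0,0,0,-1;
     0,0,-1,0,0,0,0,0]

/-- The cocharacter `ρ̌(t) = diag(t³, t², t⁻², t⁻³, t, 1, 1, t⁻¹)`. -/
def rho (k : Type*) [Field k] (t : k) : Matrix (Fin 8) (Fin 8) k :=
  Matrix.diagonal ![t^3, t^2, (t⁻¹)^2, (t⁻¹)^3, t, 1, 1, t⁻¹]

/-- The exponents of `t^3 * rho t`. -/
def rhoExp : Fin 8 → ℕ := ![6,5,1,0,4,3,3,2]

/-- The explicit lowering operator. -/
def Fmat (k : Type*) [Field k] : Matrix (Fin 8) (Fin 8) k :=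
  !![0,0,0,0,0,0,0,0;
     6,0,0,0,0,0,0,0;
     0,0,0,0,0,0,0,-10;
     0,0,-6,0,0,0,0,0;
     0,10,0,0,0,0,0,0;
     0,0,0,0,6,0,0,0;
     0,0,0,0,6,0,0,0;
     0,0,0,0,0,-6,-6,0]

lemma rho_entry (k : Type*) [Field k] (t : k) (ht : t ≠ 0) :
    rho k t = (t⁻¹)^3 • Matrix.diagonal (fun i => t ^ rhoExp i) := by
  rw [rho, ← Matrix.diagonal_smul]
  congr 1
  funext i
  fin_cases i <;> simp [rhoExp] <;> field_simp

lemma rho_det (k : Type*) [Field k] (t : k) (ht : t ≠ 0) : IsUnit (rho k t).det := by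
  rw [rho_entry k t ht, Matrix.det_smul, Matrix.det_diagonal, isUnit_iff_ne_zero]
  refine mul_ne_zero (pow_ne_zero _ (pow_ne_zero _ (inv_ne_zero ht))) ?_
  exact Finset.prod_ne_zero_iff.mpr fun i _ => pow_ne_zero _ ht

lemma rho_iff (k : Type*) [Field k] (t : k) (ht : t ≠ 0) (F : Matrix (Fin 8) (Fin 8) k) :
    rho k t * F * (rho k t)⁻¹ = t⁻¹ • F ↔
      ∀ i j, t ^ (rhoExp i + 1) * F i j = t ^ rhoExp j * F i j := by
  have hd := rho_det k t ht
  have h1 : rho k t * F * (rho k t)⁻¹ = t⁻¹ • F ↔ rho k t * F = t⁻¹ • F * rho k t := by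
    constructor
    · intro h
      rw [← h, Matrix.mul_assoc, Matrix.nonsing_inv_mul _ hd, Matrix.mul_one]
    · intro h
      rw [h, Matrix.mul_assoc, Matrix.mul_nonsing_inv _ hd, Matrix.mul_one]
  rw [h1, rho_entry k t ht, ← Matrix.ext_iff]
  refine forall_congr' fun i => forall_congr' fun j => ?_
  simp only [Matrix.smul_mul, Matrix.mul_smul, Matrix.smul_apply, Matrix.diagonal_mul,
    Matrix.mul_diagonal, smul_eq_mul]
  have h3 : (t⁻¹)^3 ≠ 0 := pow_ne_zero _ (inv_ne_zero ht)
  constructor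
  · intro h
    have h4 : t ^ rhoExp i * F i j = t⁻¹ * (F i j * t ^ rhoExp j) := by
      apply mul_left_cancel₀ h3
      linear_combination h
    rw [pow_succ]
    have h5 : t * t⁻¹ = 1 := mul_inv_cancel₀ ht
    linear_combination t * h4 + (F i j * t ^ rhoExp j) * h5
  · intro h
    rw [pow_succ] at h
    have h5 : t * t⁻¹ = 1 := mul_inv_cancel₀ ht
    linear_combination (t⁻¹)^4 * h - (t⁻¹)^3 * t ^ rhoExp i * F i j * h5

lemma gcd_fact : ∀ i j : Fin 8, rhoExp i + 1 ≠ rhoExp j →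
    Int.gcd (2 ^ (rhoExp i + 1) - 2 ^ rhoExp j) (3 ^ (rhoExp i + 1) - 3 ^ rhoExp j)
      ∣ 210 ^ 8 := by
  decide +kernel

lemma ne_210 (k : Type*) [Field k] (hch : 23 ≤ ringChar k) : (210 : k) ≠ 0 := by
  intro h
  have hp : (ringChar k).Prime :=
    (CharP.char_is_prime_or_zero k (ringChar k)).resolve_right (by omega)
  have h2 : ringChar k ∣ 210 := (ringChar.spec k 210).mp (by exact_mod_cast h)
  have h3 : ringChar k ∣ 14 * 15 := h2
  rcases hp.dvd_mul.mp h3 with h | h <;> have := Nat.le_of_dvd (by norm_num) h <;> omega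

lemma entry_zero (k : Type*) [Field k] (hch : 23 ≤ ringChar k) (F : Matrix (Fin 8) (Fin 8) k)
    (hF : ∀ t : k, t ≠ 0 → rho k t * F * (rho k t)⁻¹ = t⁻¹ • F) (i j : Fin 8)
    (hij : rhoExp i + 1 ≠ rhoExp j) : F i j = 0 := by
  have h210 := ne_210 k hch
  have ht2 : (2 : k) ≠ 0 := fun h => h210 (by linear_combination 105 * h)
  have ht3 : (3 : k) ≠ 0 := fun h => h210 (by linear_combination 70 * h)
  have e2 := (rho_iff k 2 ht2 F).mp (hF 2 ht2) i j
  have e3 := (rho_iff k 3 ht3 F).mp (hF 3 ht3) i j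
  obtain ⟨c, hc⟩ := gcd_fact i j hij
  have hb := Int.gcd_eq_gcd_ab (2 ^ (rhoExp i + 1) - 2 ^ rhoExp j)
    (3 ^ (rhoExp i + 1) - 3 ^ rhoExp j)
  generalize Int.gcdA _ _ = a at hb
  generalize Int.gcdB _ _ = b at hb
  generalize Int.gcd _ _ = g at hb hc
  have hb' := congrArg (Int.cast : ℤ → k) hb
  have hc' := congrArg (Nat.cast : ℕ → k) hc
  push_cast at hb' hc'
  have : (210 : k) ^ 8 * F i j = 0 := by
    linear_combination F i j * hc' + (c * F i j : k) * hb' + (c * a : k) * e2 + (c * b : k) * e3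
  exact (mul_eq_zero.mp this).resolve_left (pow_ne_zero _ h210)

set_option maxHeartbeats 4000000 in
/-- there is a unique matrix `F ∈ V` with `ρ̌(t) F ρ̌(t)⁻¹ = t⁻¹·F` for all
`t ∈ kˣ` and `[E,F] = diag(6,4,−4,−6,2,0,0,−2)`. -/
theorem stmt7 (k : Type*) [Field k] (hch : 23 ≤ ringChar k) :
    ∃! F : Matrix (Fin 8) (Fin 8) k,
      F ∈ VSet k
      ∧ (∀ t : k, t ≠ 0 → rho k t * F * (rho k t)⁻¹ = t⁻¹ • F)
      ∧ Emat k * F - F * Emat k = Matrix.diagonal ![6,4,-4,-6,2,0,0,-2] := by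
  refine ⟨Fmat k, ⟨⟨?_, ?_⟩, ?_, ?_⟩, ?_⟩
  · ext i j
    fin_cases i <;> fin_cases j <;>
      simp [Fmat, Psi, Matrix.mul_apply, Fin.sum_univ_succ]
  · ext i j
    rw [sMat, Matrix.mul_diagonal, Matrix.diagonal_mul]
    fin_cases i <;> fin_cases j <;> simp [Fmat]
  · intro t ht
    rw [rho_iff k t ht]
    intro i j
    fin_cases i <;> fin_cases j <;> simp [Fmat, rhoExp]
  · ext i j
    fin_cases i <;> fin_cases j <;>
      simp [Fmat, Emat, Matrix.mul_apply, Fin.sum_univ_succ] <;> norm_num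
  · rintro F ⟨-, hF, hE⟩
    have hz := entry_zero k hch F hF
    have e := fun i j => congrFun (congrFun hE i) j
    simp only [Matrix.sub_apply, Matrix.mul_apply, Fin.sum_univ_eight] at e
    have e00 := e 0 0
    have e11 := e 1 1
    have e44 := e 4 4
    have e55 := e 5 5
    have e56 := e 5 6
    have e65 := e 6 5
    have e77 := e 7 7
    have e22 := e 2 2
    have e66 := e 6 6
    have h2 : (2 : k) ≠ 0 := fun h => ne_210 k hch (by linear_combination 105 * h)
    simp [Emat] at e00 e11 e44 e55 e56 e65 e77 e22 e66
    have f10 : F 1 0 = 6 := by linear_combination e00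
    have f41 : F 4 1 = 10 := by linear_combination e11 + f10
    have f54 : F 5 4 = 6 := by
      apply mul_left_cancel₀ h2
      linear_combination e44 + f41 + e65 - e55
    have f64 : F 6 4 = 6 := by linear_combination e44 + f41 - f54
    have f75 : F 7 5 = -6 := by linear_combination -e55 - f54
    have f76 : F 7 6 = -6 := by linear_combination -e56 - f54
    have f27 : F 2 7 = -10 := by linear_combination -e77 + f75 + f76
    have f32 : F 3 2 = -6 := by linear_combination -e22 + f27
    ext i j
    by_cases hij : rhoExp i + 1 = rhoExp j
    · revert hij
      fin_cases i <;> fin_cases j <;> simp [rhoExp, Fmat, *]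
    · rw [hz i j hij]
      revert hij
      fin_cases i <;> fin_cases j <;> simp [rhoExp, Fmat]

end
end

section
/- Let k be a field with char k ≥ 23, let f be the unique matrix with f ∈ V, λ̌(t) f λ̌(t)⁻¹ = t⁻¹f for all t ∈ kˣ and [e, f] = diag(4,2,−2,−4,0,2,−2,0), and let Σ = e + {x ∈ V : [x,f] = 0}. Then there exist polynomial functions p₂, p₄, q₄, p₆ : V → k, homogeneous of degrees 2, 4, 4, 6 respectively, which are invariant in the sense that for every field extension k'/k, every v ∈ V ⊗_k k' and every g ∈ GL₈(k') with gᵀΨg = Ψ, det g = 1 and g s = s g, one has pᵢ(g v g⁻¹) = pᵢ(v), together with polynomial functions x, y : Σ → k, such that: (i) the identity y·(x·y + 2q₄) = x³ + p₂·x² + p₄·x + p₆ holds at every point of Σ; and (ii) the map Σ → k⁵ given by σ ↦ (p₂(σ), p₄(σ), q₄(σ), x(σ), y(σ)) is an isomorphism of affine varieties (a polynomial map with a polynomial inverse). -/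
open Matrix

noncomputable section

/-- The subregular nilpotent element `e`. -/
def emat (k : Type*) [Field k] : Matrix (Fin 8) (Fin 8) k :=
  !![0,1,0,0,0,1,0,0;
     0,0,0,0,1,0,0,2;
     0,0,0,-1,0,0,0,0;
     0,0,0,0,0,0,0,0;
     0,0,-2,0,0,0,1,0;
     0,0,0,0,1,0,0,-1;
     0,0,0,-1,0,0,0,0;
     0,0,-1,0,0,0,-1,0]

/-- The cocharacter `λ̌(t) = diag(t², t, t⁻¹, t⁻², 1, t, t⁻¹, 1)`. -/
def lam (k : Type*) [Field k] (t : k) : Matrix (Fin 8) (Fin 8) k :=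
  Matrix.diagonal ![t^2, t, t⁻¹, (t⁻¹)^2, 1, t, t⁻¹, 1]

/-- The subregular (affine) section `Σ = e + {x ∈ V : [x,f] = 0}`. -/
def SigmaSet (k : Type*) [Field k] (f : Matrix (Fin 8) (Fin 8) k) :
    Set (Matrix (Fin 8) (Fin 8) k) :=
  {v | ∃ z, z ∈ VSet k ∧ z * f = f * z ∧ v = emat k + z}

/-- Evaluation of a polynomial in the 64 matrix entries at a matrix. -/
def pev {k : Type*} [Field k] (P : MvPolynomial (Fin 8 × Fin 8) k)
    (m : Matrix (Fin 8) (Fin 8) k) : k :=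
  MvPolynomial.eval (fun q : Fin 8 × Fin 8 => m q.1 q.2) P


set_option linter.unusedSimpArgs false

/-- Three times the matrix `f`. -/
def Fint (k : Type*) [Field k] : Matrix (Fin 8) (Fin 8) k :=
  !![0, 0, 0, 0, 0, 0, 0, 0;
     15, 0, 0, 0, 0, 0, 0, 0;
     0, 0, 0, 0, -8, 0, 0, -5;
     0, 0, -15, 0, 0, 0, 3, 0;
     0, 5, 0, 0, 0, 7, 0, 0;
     -3, 0, 0, 0, 0, 0, 0, 0;
     0, 0, 0, 0, -4, 0, 0, -7;
     0, 8, 0, 0, 0, 4, 0, 0]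

/-- The parametrisation of the centraliser of `f` in `V`. -/
def Zmat {R : Type*} [CommRing R] (a d e u v : R) : Matrix (Fin 8) (Fin 8) R :=
  !![0, 0, 0, 0, 0, 0, 0, 0;
     -30*a - 30*d - 54*e, 0, 0, 0, 0, 0, 0, 0;
     u, 0, 0, 0, 18*a + 28*d + 20*e, 0, 0, 9*a + 4*d - 8*e;
     0, -u, 30*a + 30*d + 54*e, 0, 0, v, -6*a - 6*d - 54*e, 0;
     0, -9*a - 4*d + 8*e, 0, 0, 0, -9*a + 16*d + 4*e, 0, 0;
     6*a + 6*d + 54*e, 0, 0, 0, 0, 0, 0, 0;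
     -v, 0, 0, 0, 18*a + 68*d + 28*e, 0, 0, 9*a - 16*d - 4*e;
     0, -18*a - 28*d - 20*e, 0, 0, 0, -18*a - 68*d - 28*e, 0, 0]

/-- The parametrisation of the slice. -/
def Smat {R : Type*} [CommRing R] (a d e u v : R) : Matrix (Fin 8) (Fin 8) R :=
  !![0, 1, 0, 0, 0, 1, 0, 0;
     -30*a - 30*d - 54*e, 0, 0, 0, 1, 0, 0, 2;
     u, 0, 0, -1, 18*a + 28*d + 20*e, 0, 0, 9*a + 4*d - 8*e;
     0, -u, 30*a + 30*d + 54*e, 0, 0, v, -6*a - 6*d - 54*e, 0;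
     0, -9*a - 4*d + 8*e, -2, 0, 0, -9*a + 16*d + 4*e, 1, 0;
     6*a + 6*d + 54*e, 0, 0, 0, 1, 0, 0, -1;
     -v, 0, 0, -1, 18*a + 68*d + 28*e, 0, 0, 9*a - 16*d - 4*e;
     0, -18*a - 28*d - 20*e, -1, 0, 0, -18*a - 68*d - 28*e, -1, 0]

/-- The involution of the indices given by `Ψ`. -/
def psi : Fin 8 → Fin 8 := ![3,2,1,0,7,6,5,4]

lemma nz {k : Type*} [Field k] (hch : 23 ≤ ringChar k) (n : ℕ) (hn : n ∣ 210 ^ 6) : (n : k) ≠ 0 := by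
  intro h
  have hp : (ringChar k).Prime := by
    rcases CharP.char_is_prime_or_zero k (ringChar k) with h | h
    · exact h
    · omega
  have h1 : ringChar k ∣ 210 ^ 6 := (ringChar.dvd h).trans hn
  have h2 : ringChar k ∣ 210 := hp.dvd_of_dvd_pow h1
  have h3 : ringChar k ∣ 2 * 3 * 5 * 7 := h2
  rw [hp.dvd_mul, hp.dvd_mul, hp.dvd_mul] at h3
  rcases h3 with ((h | h) | h) | h <;> have := Nat.le_of_dvd (by norm_num) h <;> omega

lemma so_entry {k : Type*} [Field k] {z : Matrix (Fin 8) (Fin 8) k} (h : zᵀ * Psi k = -(Psi k * z))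
    (i j : Fin 8) : z (psi j) i + z (psi i) j = 0 := by
  have h' := congrFun (congrFun h i) j
  simp only [Matrix.mul_apply, Fin.sum_univ_eight, Matrix.neg_apply, Matrix.transpose_apply, Matrix.sub_apply] at h'
  fin_cases i <;> fin_cases j <;>
    simp [Psi, psi] at h' ⊢ <;> linear_combination h'

lemma s_entry {k : Type*} [Field k] (h2 : (2 : k) ≠ 0) {z : Matrix (Fin 8) (Fin 8) k}
    (h : sMat k * z * sMat k = -z) (i j : Fin 8)
    (hij : (![1,-1,-1,1,1,-1,-1,1] : Fin 8 → ℤ) i = (![1,-1,-1,1,1,-1,-1,1] : Fin 8 → ℤ) j) :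
    z i j = 0 := by
  have h' := congrFun (congrFun h i) j
  simp only [sMat, Matrix.mul_diagonal, Matrix.diagonal_mul, Matrix.neg_apply] at h'
  revert hij
  fin_cases i <;> fin_cases j <;> simp at h' ⊢ <;> grind

lemma wt_entry {k : Type*} [Field k] (h3 : (3 : k) ≠ 0) {f : Matrix (Fin 8) (Fin 8) k}
    (h : lam k 3 * f * (lam k 3)⁻¹ = (3 : k)⁻¹ • f) (i j : Fin 8) :
    (3 * (![81,27,3,1,9,27,3,9] : Fin 8 → k) i - (![81,27,3,1,9,27,3,9] : Fin 8 → k) j) * f i j = 0 := by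
  have hdet : IsUnit (lam k 3).det := by
    rw [lam, Matrix.det_diagonal, isUnit_iff_ne_zero, Finset.prod_ne_zero_iff]
    intro i _
    fin_cases i <;> simp [h3]
  have h1 : lam k 3 * f = ((3 : k)⁻¹ • f) * lam k 3 := by
    rw [← h, Matrix.nonsing_inv_mul_cancel_right _ _ hdet]
  have h' := congrFun (congrFun h1 i) j
  simp only [lam, Matrix.mul_diagonal, Matrix.diagonal_mul, Matrix.smul_apply, smul_eq_mul] at h'
  have hL : ∀ i : Fin 8, (![81,27,3,1,9,27,3,9] : Fin 8 → k) i
      = 9 * (![3^2, 3, 3⁻¹, (3⁻¹)^2, 1, 3, 3⁻¹, 1] : Fin 8 → k) i := by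
    intro i
    fin_cases i <;> simp <;> field_simp <;> norm_num
  rw [hL, hL]
  generalize (![3^2, 3, 3⁻¹, (3⁻¹)^2, 1, 3, 3⁻¹, 1] : Fin 8 → k) i = x at *
  generalize (![3^2, 3, 3⁻¹, (3⁻¹)^2, 1, 3, 3⁻¹, 1] : Fin 8 → k) j = y at *
  have h33 : (3 : k) * 3⁻¹ = 1 := mul_inv_cancel₀ h3
  linear_combination 27 * h' + 9 * f i j * y * h33

set_option maxHeartbeats 4000000 in
lemma f_eq {k : Type*} [Field k] (hch : 23 ≤ ringChar k)
    (f : Matrix (Fin 8) (Fin 8) k) (hfV : f ∈ VSet k)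
    (hfwt : ∀ t : k, t ≠ 0 → lam k t * f * (lam k t)⁻¹ = t⁻¹ • f)
    (hef : emat k * f - f * emat k = Matrix.diagonal ![4,2,-2,-4,0,2,-2,0]) :
    f = (3 : k)⁻¹ • Fint k := by
  have h2 : (2 : k) ≠ 0 := by exact_mod_cast nz hch 2 (by norm_num)
  have h3 : (3 : k) ≠ 0 := by exact_mod_cast nz hch 3 (by norm_num)
  have hs := s_entry h2 hfV.2
  have hso := so_entry hfV.1
  have hw := wt_entry h3 (hfwt 3 h3)
  have hb : ∀ i j, (emat k * f - f * emat k) i j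
      = (Matrix.diagonal ![4,2,-2,-4,0,2,-2,0] : Matrix (Fin 8) (Fin 8) k) i j := by
    intro i j
    rw [hef]
  have f00 : f 0 0 = 0 := hs 0 0 rfl
  have f01 : f 0 1 = 0 := by
    apply mul_left_cancel₀ (nz hch 216 (by norm_num))
    have := hw 0 1
    simp at this ⊢
    grind
  have f02 : f 0 2 = 0 := by
    apply mul_left_cancel₀ (nz hch 240 (by norm_num))
    have := hw 0 2
    simp at this ⊢
    grind
  have f03 : f 0 3 = 0 := hs 0 3 rfl
  have f04 : f 0 4 = 0 := hs 0 4 rfl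
  have f05 : f 0 5 = 0 := by
    apply mul_left_cancel₀ (nz hch 216 (by norm_num))
    have := hw 0 5
    simp at this ⊢
    grind
  have f06 : f 0 6 = 0 := by
    apply mul_left_cancel₀ (nz hch 240 (by norm_num))
    have := hw 0 6
    simp at this ⊢
    grind
  have f07 : f 0 7 = 0 := hs 0 7 rfl
  have f11 : f 1 1 = 0 := hs 1 1 rfl
  have f12 : f 1 2 = 0 := hs 1 2 rfl
  have f13 : f 1 3 = 0 := by
    apply mul_left_cancel₀ (nz hch 80 (by norm_num))
    have := hw 1 3
    simp at this ⊢
    grind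
  have f14 : f 1 4 = 0 := by
    apply mul_left_cancel₀ (nz hch 72 (by norm_num))
    have := hw 1 4
    simp at this ⊢
    grind
  have f15 : f 1 5 = 0 := hs 1 5 rfl
  have f16 : f 1 6 = 0 := hs 1 6 rfl
  have f17 : f 1 7 = 0 := by
    apply mul_left_cancel₀ (nz hch 72 (by norm_num))
    have := hw 1 7
    simp at this ⊢
    grind
  have f20 : f 2 0 = 0 := by
    apply mul_left_cancel₀ (nz hch 72 (by norm_num))
    have := hw 2 0
    simp at this ⊢
    grind
  have f21 : f 2 1 = 0 := hs 2 1 rfl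
  have f22 : f 2 2 = 0 := hs 2 2 rfl
  have f23 : f 2 3 = 0 := by
    apply mul_left_cancel₀ (nz hch 8 (by norm_num))
    have := hw 2 3
    simp at this ⊢
    grind
  have f25 : f 2 5 = 0 := hs 2 5 rfl
  have f26 : f 2 6 = 0 := hs 2 6 rfl
  have f30 : f 3 0 = 0 := hs 3 0 rfl
  have f31 : f 3 1 = 0 := by
    apply mul_left_cancel₀ (nz hch 24 (by norm_num))
    have := hw 3 1
    simp at this ⊢
    grind
  have f33 : f 3 3 = 0 := hs 3 3 rfl
  have f34 : f 3 4 = 0 := hs 3 4 rfl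
  have f35 : f 3 5 = 0 := by
    apply mul_left_cancel₀ (nz hch 24 (by norm_num))
    have := hw 3 5
    simp at this ⊢
    grind
  have f37 : f 3 7 = 0 := hs 3 7 rfl
  have f40 : f 4 0 = 0 := hs 4 0 rfl
  have f42 : f 4 2 = 0 := by
    apply mul_left_cancel₀ (nz hch 24 (by norm_num))
    have := hw 4 2
    simp at this ⊢
    grind
  have f43 : f 4 3 = 0 := hs 4 3 rfl
  have f44 : f 4 4 = 0 := hs 4 4 rfl
  have f46 : f 4 6 = 0 := by
    apply mul_left_cancel₀ (nz hch 24 (by norm_num))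
    have := hw 4 6
    simp at this ⊢
    grind
  have f47 : f 4 7 = 0 := hs 4 7 rfl
  have f51 : f 5 1 = 0 := hs 5 1 rfl
  have f52 : f 5 2 = 0 := hs 5 2 rfl
  have f53 : f 5 3 = 0 := by
    apply mul_left_cancel₀ (nz hch 80 (by norm_num))
    have := hw 5 3
    simp at this ⊢
    grind
  have f54 : f 5 4 = 0 := by
    apply mul_left_cancel₀ (nz hch 72 (by norm_num))
    have := hw 5 4
    simp at this ⊢
    grind
  have f55 : f 5 5 = 0 := hs 5 5 rfl
  have f56 : f 5 6 = 0 := hs 5 6 rfl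
  have f57 : f 5 7 = 0 := by
    apply mul_left_cancel₀ (nz hch 72 (by norm_num))
    have := hw 5 7
    simp at this ⊢
    grind
  have f60 : f 6 0 = 0 := by
    apply mul_left_cancel₀ (nz hch 72 (by norm_num))
    have := hw 6 0
    simp at this ⊢
    grind
  have f61 : f 6 1 = 0 := hs 6 1 rfl
  have f62 : f 6 2 = 0 := hs 6 2 rfl
  have f63 : f 6 3 = 0 := by
    apply mul_left_cancel₀ (nz hch 8 (by norm_num))
    have := hw 6 3
    simp at this ⊢
    grind
  have f65 : f 6 5 = 0 := hs 6 5 rfl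
  have f66 : f 6 6 = 0 := hs 6 6 rfl
  have f70 : f 7 0 = 0 := hs 7 0 rfl
  have f72 : f 7 2 = 0 := by
    apply mul_left_cancel₀ (nz hch 24 (by norm_num))
    have := hw 7 2
    simp at this ⊢
    grind
  have f73 : f 7 3 = 0 := hs 7 3 rfl
  have f74 : f 7 4 = 0 := hs 7 4 rfl
  have f76 : f 7 6 = 0 := by
    apply mul_left_cancel₀ (nz hch 24 (by norm_num))
    have := hw 7 6
    simp at this ⊢
    grind
  have f77 : f 7 7 = 0 := hs 7 7 rfl
  have b00 := hb 0 0
  simp only [Matrix.mul_apply, Fin.sum_univ_eight, Matrix.neg_apply, Matrix.transpose_apply, Matrix.sub_apply] at b00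
  simp [emat, f00, f01, f02, f03, f04, f05, f06, f07, f20, f30, f40, f60, f70] at b00
  have b11 := hb 1 1
  simp only [Matrix.mul_apply, Fin.sum_univ_eight, Matrix.neg_apply, Matrix.transpose_apply, Matrix.sub_apply] at b11
  simp [emat, f01, f11, f12, f13, f14, f15, f16, f17, f21, f31, f51, f61] at b11
  have b15 := hb 1 5
  simp only [Matrix.mul_apply, Fin.sum_univ_eight, Matrix.neg_apply, Matrix.transpose_apply, Matrix.sub_apply] at b15
  simp [emat, f05, f11, f12, f13, f14, f15, f16, f17, f25, f35, f55, f65] at b15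
  have b26 := hb 2 6
  simp only [Matrix.mul_apply, Fin.sum_univ_eight, Matrix.neg_apply, Matrix.transpose_apply, Matrix.sub_apply] at b26
  simp [emat, f06, f16, f20, f21, f22, f23, f25, f26, f46, f56, f66, f76] at b26
  have b44 := hb 4 4
  simp only [Matrix.mul_apply, Fin.sum_univ_eight, Matrix.neg_apply, Matrix.transpose_apply, Matrix.sub_apply] at b44
  simp [emat, f04, f14, f34, f40, f42, f43, f44, f46, f47, f54, f74] at b44
  have b55 := hb 5 5
  simp only [Matrix.mul_apply, Fin.sum_univ_eight, Matrix.neg_apply, Matrix.transpose_apply, Matrix.sub_apply] at b55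
  simp [emat, f05, f15, f25, f35, f51, f52, f53, f54, f55, f56, f57, f65] at b55
  have so02 := hso 0 2
  simp [psi] at so02
  have so06 := hso 0 6
  simp [psi] at so06
  have so14 := hso 1 4
  simp [psi] at so14
  have so17 := hso 1 7
  simp [psi] at so17
  have so45 := hso 4 5
  simp [psi] at so45
  have so57 := hso 5 7
  simp [psi] at so57
  have f10 : 3 * f 1 0 = 15 := by
    apply mul_left_cancel₀ (nz hch 4 (by norm_num))
    push_cast
    linear_combination (15)*b00 + (-12)*so06 + (-12)*b26 + (-3)*b11 + (6)*so14 + (12)*so17 + (9)*b44 + (-9)*so45 + (6)*b15 + (3)*b55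
  have f24 : 3 * f 2 4 = -8 := by
    apply mul_left_cancel₀ (nz hch 2 (by norm_num))
    push_cast
    linear_combination (-1)*b11 + (-3)*b00 + (2)*so06 + (2)*b26 + (2)*so14 + (-2)*so17 + (-3)*b44 + (3)*so45 + (-2)*b15 + (-1)*b55
  have f27 : 3 * f 2 7 = -5 := by
    apply mul_left_cancel₀ (nz hch 4 (by norm_num))
    push_cast
    linear_combination (3)*b44 + (8)*so17 + (-3)*so45 + (2)*b15 + (-3)*b00 + (4)*so06 + (4)*b26 + (-5)*b11 + (10)*so14 + (1)*b55
  have f32 : 3 * f 3 2 = -15 := by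
    apply mul_left_cancel₀ (nz hch 4 (by norm_num))
    push_cast
    linear_combination (-15)*b00 + (12)*so02 + (12)*so06 + (12)*b26 + (3)*b11 + (-6)*so14 + (-12)*so17 + (-9)*b44 + (9)*so45 + (-6)*b15 + (-3)*b55
  have f36 : 3 * f 3 6 = 3 := by
    apply mul_left_cancel₀ (nz hch 4 (by norm_num))
    push_cast
    linear_combination (-12)*b26 + (-3)*b11 + (3)*b00 + (6)*so14 + (12)*so17 + (9)*b44 + (-9)*so45 + (6)*b15 + (3)*b55
  have f41 : 3 * f 4 1 = 5 := by
    apply mul_left_cancel₀ (nz hch 4 (by norm_num))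
    push_cast
    linear_combination (4)*so17 + (-3)*b44 + (3)*so45 + (-2)*b15 + (3)*b00 + (-4)*so06 + (-4)*b26 + (5)*b11 + (-10)*so14 + (-1)*b55
  have f45 : 3 * f 4 5 = 7 := by
    apply mul_left_cancel₀ (nz hch 4 (by norm_num))
    push_cast
    linear_combination (7)*b55 + (4)*so06 + (4)*b26 + (1)*b11 + (3)*b00 + (-2)*so14 + (-4)*so17 + (-3)*b44 + (3)*so45 + (2)*b15
  have f50 : 3 * f 5 0 = -3 := by
    apply mul_left_cancel₀ (nz hch 4 (by norm_num))
    push_cast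
    linear_combination (12)*so06 + (12)*b26 + (3)*b11 + (-3)*b00 + (-6)*so14 + (-12)*so17 + (-9)*b44 + (9)*so45 + (-6)*b15 + (-3)*b55
  have f64 : 3 * f 6 4 = -4 := by
    apply mul_left_cancel₀ (nz hch 2 (by norm_num))
    push_cast
    linear_combination (9)*so45 + (-4)*b15 + (-3)*b00 + (4)*so06 + (4)*b26 + (1)*b11 + (-2)*so14 + (-4)*so17 + (-3)*b44 + (1)*b55
  have f67 : 3 * f 6 7 = -7 := by
    apply mul_left_cancel₀ (nz hch 4 (by norm_num))
    push_cast
    linear_combination (-7)*b55 + (-4)*so06 + (-4)*b26 + (-1)*b11 + (-3)*b00 + (2)*so14 + (4)*so17 + (3)*b44 + (-3)*so45 + (-2)*b15 + (12)*so57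
  have f71 : 3 * f 7 1 = 8 := by
    apply mul_left_cancel₀ (nz hch 2 (by norm_num))
    push_cast
    linear_combination (4)*so14 + (1)*b11 + (3)*b00 + (-2)*so06 + (-2)*b26 + (2)*so17 + (3)*b44 + (-3)*so45 + (2)*b15 + (1)*b55
  have f75 : 3 * f 7 5 = 4 := by
    apply mul_left_cancel₀ (nz hch 2 (by norm_num))
    push_cast
    linear_combination (4)*b15 + (3)*b00 + (-4)*so06 + (-4)*b26 + (-1)*b11 + (2)*so14 + (4)*so17 + (3)*b44 + (-3)*so45 + (-1)*b55
  ext i j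
  rw [Matrix.smul_apply, smul_eq_mul, eq_inv_mul_iff_mul_eq₀ h3]
  fin_cases i <;> fin_cases j <;> simp [Fint, f00, f01, f02, f03, f04, f05, f06, f07, f10, f11, f12, f13, f14, f15, f16, f17, f20, f21, f22, f23, f24, f25, f26, f27, f30, f31, f32, f33, f34, f35, f36, f37, f40, f41, f42, f43, f44, f45, f46, f47, f50, f51, f52, f53, f54, f55, f56, f57, f60, f61, f62, f63, f64, f65, f66, f67, f70, f71, f72, f73, f74, f75, f76, f77]

set_option maxHeartbeats 4000000 in
lemma z_eq {k : Type*} [Field k] (hch : 23 ≤ ringChar k)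
    (z : Matrix (Fin 8) (Fin 8) k) (hzV : z ∈ VSet k) (hc : z * Fint k = Fint k * z) :
    ∃ a d e u v, z = Zmat a d e u v := by
  have h2 : (2 : k) ≠ 0 := by exact_mod_cast nz hch 2 (by norm_num)
  have h1080 : (1080 : k) ≠ 0 := by exact_mod_cast nz hch 1080 (by norm_num)
  have hs := s_entry h2 hzV.2
  have hso := so_entry hzV.1
  have hb : ∀ i j, (z * Fint k - Fint k * z) i j = 0 := by
    intro i j
    rw [hc, sub_self, Matrix.zero_apply]
  obtain ⟨a, ha⟩ : ∃ a, 1080 * a = -46*z 1 0 - 54*z 2 7 + 50*z 3 6 - 54*z 4 5 :=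
    ⟨1080⁻¹ * (-46*z 1 0 - 54*z 2 7 + 50*z 3 6 - 54*z 4 5), by rw [mul_inv_cancel_left₀ h1080]⟩
  obtain ⟨d, hd⟩ : ∃ d, 1080 * d = z 1 0 + 54*z 2 7 - 5*z 3 6 + 54*z 4 5 :=
    ⟨1080⁻¹ * (z 1 0 + 54*z 2 7 - 5*z 3 6 + 54*z 4 5), by rw [mul_inv_cancel_left₀ h1080]⟩
  obtain ⟨e, he⟩ : ∃ e, 1080 * e = 5*z 1 0 - 25*z 3 6 :=
    ⟨1080⁻¹ * (5*z 1 0 - 25*z 3 6), by rw [mul_inv_cancel_left₀ h1080]⟩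
  have z00 : z 0 0 = 0 := hs 0 0 rfl
  have z03 : z 0 3 = 0 := hs 0 3 rfl
  have z04 : z 0 4 = 0 := hs 0 4 rfl
  have z07 : z 0 7 = 0 := hs 0 7 rfl
  have z11 : z 1 1 = 0 := hs 1 1 rfl
  have z12 : z 1 2 = 0 := hs 1 2 rfl
  have z15 : z 1 5 = 0 := hs 1 5 rfl
  have z16 : z 1 6 = 0 := hs 1 6 rfl
  have z21 : z 2 1 = 0 := hs 2 1 rfl
  have z22 : z 2 2 = 0 := hs 2 2 rfl
  have z25 : z 2 5 = 0 := hs 2 5 rfl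
  have z26 : z 2 6 = 0 := hs 2 6 rfl
  have z30 : z 3 0 = 0 := hs 3 0 rfl
  have z33 : z 3 3 = 0 := hs 3 3 rfl
  have z34 : z 3 4 = 0 := hs 3 4 rfl
  have z37 : z 3 7 = 0 := hs 3 7 rfl
  have z40 : z 4 0 = 0 := hs 4 0 rfl
  have z43 : z 4 3 = 0 := hs 4 3 rfl
  have z44 : z 4 4 = 0 := hs 4 4 rfl
  have z47 : z 4 7 = 0 := hs 4 7 rfl
  have z51 : z 5 1 = 0 := hs 5 1 rfl
  have z52 : z 5 2 = 0 := hs 5 2 rfl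
  have z55 : z 5 5 = 0 := hs 5 5 rfl
  have z56 : z 5 6 = 0 := hs 5 6 rfl
  have z61 : z 6 1 = 0 := hs 6 1 rfl
  have z62 : z 6 2 = 0 := hs 6 2 rfl
  have z65 : z 6 5 = 0 := hs 6 5 rfl
  have z66 : z 6 6 = 0 := hs 6 6 rfl
  have z70 : z 7 0 = 0 := hs 7 0 rfl
  have z73 : z 7 3 = 0 := hs 7 3 rfl
  have z74 : z 7 4 = 0 := hs 7 4 rfl
  have z77 : z 7 7 = 0 := hs 7 7 rfl
  have b00 := hb 0 0
  simp only [Matrix.mul_apply, Fin.sum_univ_eight, Matrix.neg_apply, Matrix.transpose_apply, Matrix.sub_apply] at b00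
  simp [Fint, z00, z03, z04, z07, z30, z40, z70] at b00
  have b04 := hb 0 4
  simp only [Matrix.mul_apply, Fin.sum_univ_eight, Matrix.neg_apply, Matrix.transpose_apply, Matrix.sub_apply] at b04
  simp [Fint, z00, z03, z04, z07, z34, z44, z74] at b04
  have b07 := hb 0 7
  simp only [Matrix.mul_apply, Fin.sum_univ_eight, Matrix.neg_apply, Matrix.transpose_apply, Matrix.sub_apply] at b07
  simp [Fint, z00, z03, z04, z07, z37, z47, z77] at b07
  have b11 := hb 1 1
  simp only [Matrix.mul_apply, Fin.sum_univ_eight, Matrix.neg_apply, Matrix.transpose_apply, Matrix.sub_apply] at b11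
  simp [Fint, z11, z12, z15, z16, z21, z51, z61] at b11
  have b12 := hb 1 2
  simp only [Matrix.mul_apply, Fin.sum_univ_eight, Matrix.neg_apply, Matrix.transpose_apply, Matrix.sub_apply] at b12
  simp [Fint, z11, z12, z15, z16, z22, z52, z62] at b12
  have b15 := hb 1 5
  simp only [Matrix.mul_apply, Fin.sum_univ_eight, Matrix.neg_apply, Matrix.transpose_apply, Matrix.sub_apply] at b15
  simp [Fint, z11, z12, z15, z16, z25, z55, z65] at b15
  have b25 := hb 2 5
  simp only [Matrix.mul_apply, Fin.sum_univ_eight, Matrix.neg_apply, Matrix.transpose_apply, Matrix.sub_apply] at b25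
  simp [Fint, z15, z21, z22, z25, z26, z55, z65] at b25
  have b26 := hb 2 6
  simp only [Matrix.mul_apply, Fin.sum_univ_eight, Matrix.neg_apply, Matrix.transpose_apply, Matrix.sub_apply] at b26
  simp [Fint, z16, z21, z22, z25, z26, z56, z66] at b26
  have b33 := hb 3 3
  simp only [Matrix.mul_apply, Fin.sum_univ_eight, Matrix.neg_apply, Matrix.transpose_apply, Matrix.sub_apply] at b33
  simp [Fint, z03, z30, z33, z34, z37, z43, z73] at b33
  have b34 := hb 3 4
  simp only [Matrix.mul_apply, Fin.sum_univ_eight, Matrix.neg_apply, Matrix.transpose_apply, Matrix.sub_apply] at b34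
  simp [Fint, z04, z30, z33, z34, z37, z44, z74] at b34
  have b37 := hb 3 7
  simp only [Matrix.mul_apply, Fin.sum_univ_eight, Matrix.neg_apply, Matrix.transpose_apply, Matrix.sub_apply] at b37
  simp [Fint, z07, z30, z33, z34, z37, z47, z77] at b37
  have b43 := hb 4 3
  simp only [Matrix.mul_apply, Fin.sum_univ_eight, Matrix.neg_apply, Matrix.transpose_apply, Matrix.sub_apply] at b43
  simp [Fint, z03, z33, z40, z43, z44, z47, z73] at b43
  have b44 := hb 4 4
  simp only [Matrix.mul_apply, Fin.sum_univ_eight, Matrix.neg_apply, Matrix.transpose_apply, Matrix.sub_apply] at b44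
  simp [Fint, z04, z34, z40, z43, z44, z47, z74] at b44
  have b55 := hb 5 5
  simp only [Matrix.mul_apply, Fin.sum_univ_eight, Matrix.neg_apply, Matrix.transpose_apply, Matrix.sub_apply] at b55
  simp [Fint, z15, z25, z51, z52, z55, z56, z65] at b55
  have so01 := hso 0 1
  simp [psi] at so01
  have so02 := hso 0 2
  simp [psi] at so02
  have so05 := hso 0 5
  simp [psi] at so05
  have so06 := hso 0 6
  simp [psi] at so06
  have so13 := hso 1 3
  simp [psi] at so13
  have so14 := hso 1 4
  simp [psi] at so14
  have so17 := hso 1 7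
  simp [psi] at so17
  have so24 := hso 2 4
  simp [psi] at so24
  have so27 := hso 2 7
  simp [psi] at so27
  have so45 := hso 4 5
  simp [psi] at so45
  have so46 := hso 4 6
  simp [psi] at so46
  have so57 := hso 5 7
  simp [psi] at so57
  have so67 := hso 6 7
  simp [psi] at so67
  have z01 : z 0 1 = 0 := by
    apply mul_left_cancel₀ (nz hch 972 (by norm_num))
    push_cast
    linear_combination (42)*so13 + (-9)*b44 + (-72)*so27 + (-20)*b15 + (81)*b00 + (19)*b11 + (70)*so46 + (-14)*b26 + (76)*so67 + (-19)*b55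
  have z02 : z 0 2 = 0 := by
    apply mul_left_cancel₀ (nz hch 36 (by norm_num))
    push_cast
    linear_combination (-7)*b04 + (4)*b07
  have z05 : z 0 5 = 0 := by
    apply mul_left_cancel₀ (nz hch 972 (by norm_num))
    push_cast
    linear_combination (210)*so13 + (81)*b00 + (-45)*b44 + (-360)*so27 + (-100)*b15 + (95)*b11 + (350)*so46 + (-70)*b26 + (380)*so67 + (-95)*b55
  have z06 : z 0 6 = 0 := by
    apply mul_left_cancel₀ (nz hch 36 (by norm_num))
    push_cast
    linear_combination (-8)*b07 + (5)*b04
  have z10 : z 1 0 = -30*a - 30*d - 54*e := by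
    apply mul_left_cancel₀ (nz hch 180 (by norm_num))
    push_cast
    linear_combination (9)*he + (5)*ha + (5)*hd
  have z13 : z 1 3 = 0 := by
    apply mul_left_cancel₀ (nz hch 180 (by norm_num))
    push_cast
    linear_combination (-12)*b12 + (35)*b04 + (-20)*b07
  have z14 : z 1 4 = 0 := by
    apply mul_left_cancel₀ (nz hch 324 (by norm_num))
    push_cast
    linear_combination (59)*b11 + (210)*so13 + (-28)*b15 + (45)*b00 + (-45)*b44 + (-360)*so27 + (350)*so46 + (-70)*b26 + (380)*so67 + (-95)*b55
  have z17 : z 1 7 = 0 := by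
    apply mul_left_cancel₀ (nz hch 648 (by norm_num))
    push_cast
    linear_combination (10)*b15 + (-210)*so13 + (45)*b00 + (31)*b11 + (45)*b44 + (360)*so27 + (-350)*so46 + (70)*b26 + (-380)*so67 + (95)*b55
  have z23 : z 2 3 = 0 := by
    apply mul_left_cancel₀ (nz hch 972 (by norm_num))
    push_cast
    linear_combination (9)*b44 + (72)*so27 + (20)*b15 + (930)*so13 + (-81)*b00 + (-19)*b11 + (-70)*so46 + (14)*b26 + (-76)*so67 + (19)*b55
  have z24 : z 2 4 = 18*a + 28*d + 20*e := by
    apply mul_left_cancel₀ (nz hch 540 (by norm_num))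
    push_cast
    linear_combination (-10)*he + (350)*so02 + (50)*b34 + (150)*so45 + (-30)*b25 + (-30)*so57 + (-10)*b37 + (-9)*ha + (-14)*hd
  have z27 : z 2 7 = 9*a + 4*d - 8*e := by
    apply mul_left_cancel₀ (nz hch 1080 (by norm_num))
    push_cast
    linear_combination (8)*he + (450)*so02 + (270)*so57 + (90)*b37 + (-9)*ha + (-4)*hd
  have z31 : z 3 1 = -z 2 0 := by
    apply mul_left_cancel₀ (nz hch 1 (by norm_num))
    push_cast
    linear_combination (1)*so01
  have z32 : z 3 2 = 30*a + 30*d + 54*e := by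
    apply mul_left_cancel₀ (nz hch 180 (by norm_num))
    push_cast
    linear_combination (-9)*he + (180)*so02 + (-5)*ha + (-5)*hd
  have z36 : z 3 6 = -6*a - 6*d - 54*e := by
    apply mul_left_cancel₀ (nz hch 180 (by norm_num))
    push_cast
    linear_combination (9)*he + (1)*ha + (1)*hd
  have z41 : z 4 1 = -9*a - 4*d + 8*e := by
    apply mul_left_cancel₀ (nz hch 1080 (by norm_num))
    push_cast
    linear_combination (1080)*so17 + (-8)*he + (-450)*so02 + (-270)*so57 + (-90)*b37 + (9)*ha + (4)*hd
  have z42 : z 4 2 = 0 := by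
    apply mul_left_cancel₀ (nz hch 648 (by norm_num))
    push_cast
    linear_combination (288)*so27 + (-10)*b15 + (210)*so13 + (-45)*b00 + (-31)*b11 + (-45)*b44 + (350)*so46 + (-70)*b26 + (380)*so67 + (-95)*b55
  have z45 : z 4 5 = -9*a + 16*d + 4*e := by
    apply mul_left_cancel₀ (nz hch 1080 (by norm_num))
    push_cast
    linear_combination (-270)*so57 + (-4)*he + (-450)*so02 + (-90)*b37 + (9)*ha + (-16)*hd
  have z46 : z 4 6 = 0 := by
    apply mul_left_cancel₀ (nz hch 648 (by norm_num))
    push_cast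
    linear_combination (-436)*so67 + (109)*b55 + (-420)*so13 + (9)*b00 + (-700)*so46 + (140)*b26 + (9)*b44 + (72)*so27 + (20)*b15 + (-19)*b11
  have z50 : z 5 0 = 6*a + 6*d + 54*e := by
    apply mul_left_cancel₀ (nz hch 180 (by norm_num))
    push_cast
    linear_combination (180)*so06 + (-9)*he + (-1)*ha + (-1)*hd
  have z53 : z 5 3 = 0 := by
    apply mul_left_cancel₀ (nz hch 252 (by norm_num))
    push_cast
    linear_combination (-36)*b43 + (12)*b12 + (-35)*b04 + (20)*b07
  have z54 : z 5 4 = 0 := by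
    apply mul_left_cancel₀ (nz hch 324 (by norm_num))
    push_cast
    linear_combination (-250)*so46 + (50)*b26 + (-364)*so67 + (91)*b55 + (-150)*so13 + (-9)*b00 + (9)*b44 + (72)*so27 + (20)*b15 + (-19)*b11
  have z57 : z 5 7 = 0 := by
    apply mul_left_cancel₀ (nz hch 648 (by norm_num))
    push_cast
    linear_combination (-109)*b55 + (420)*so13 + (-9)*b00 + (700)*so46 + (-140)*b26 + (1084)*so67 + (-9)*b44 + (-72)*so27 + (-20)*b15 + (19)*b11
  have z60 : z 6 0 = -z 3 5 := by
    apply mul_left_cancel₀ (nz hch 1 (by norm_num))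
    push_cast
    linear_combination (1)*so05
  have z63 : z 6 3 = 0 := by
    apply mul_left_cancel₀ (nz hch 972 (by norm_num))
    push_cast
    linear_combination (45)*b44 + (360)*so27 + (100)*b15 + (4650)*so13 + (-405)*b00 + (-324)*b33 + (-95)*b11 + (-350)*so46 + (70)*b26 + (-380)*so67 + (95)*b55
  have z64 : z 6 4 = 18*a + 68*d + 28*e := by
    apply mul_left_cancel₀ (nz hch 540 (by norm_num))
    push_cast
    linear_combination (750)*so45 + (-14)*he + (310)*so02 + (70)*b34 + (-150)*b25 + (-150)*so57 + (-50)*b37 + (-9)*ha + (-34)*hd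
  have z67 : z 6 7 = 9*a - 16*d - 4*e := by
    apply mul_left_cancel₀ (nz hch 1080 (by norm_num))
    push_cast
    linear_combination (4)*he + (450)*so02 + (1350)*so57 + (90)*b37 + (-9)*ha + (16)*hd
  have z71 : z 7 1 = -18*a - 28*d - 20*e := by
    apply mul_left_cancel₀ (nz hch 540 (by norm_num))
    push_cast
    linear_combination (540)*so14 + (30)*b25 + (30)*so57 + (10)*he + (-350)*so02 + (-50)*b34 + (-150)*so45 + (10)*b37 + (9)*ha + (14)*hd
  have z72 : z 7 2 = 0 := by
    apply mul_left_cancel₀ (nz hch 324 (by norm_num))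
    push_cast
    linear_combination (324)*so24 + (-59)*b11 + (-210)*so13 + (28)*b15 + (-45)*b00 + (45)*b44 + (360)*so27 + (-350)*so46 + (70)*b26 + (-380)*so67 + (95)*b55
  have z75 : z 7 5 = -18*a - 68*d - 28*e := by
    apply mul_left_cancel₀ (nz hch 540 (by norm_num))
    push_cast
    linear_combination (14)*he + (-310)*so02 + (-70)*b34 + (-210)*so45 + (150)*b25 + (150)*so57 + (50)*b37 + (9)*ha + (34)*hd
  have z76 : z 7 6 = 0 := by
    apply mul_left_cancel₀ (nz hch 324 (by norm_num))
    push_cast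
    linear_combination (-50)*b26 + (364)*so67 + (-91)*b55 + (150)*so13 + (9)*b00 + (574)*so46 + (-9)*b44 + (-72)*so27 + (-20)*b15 + (19)*b11
  refine ⟨a, d, e, z 2 0, z 3 5, ?_⟩
  ext i j
  fin_cases i <;> fin_cases j <;> simp [Zmat, z00, z01, z02, z03, z04, z05, z06, z07, z10, z11, z12, z13, z14, z15, z16, z17, z21, z22, z23, z24, z25, z26, z27, z30, z31, z32, z33, z34, z36, z37, z40, z41, z42, z43, z44, z45, z46, z47, z50, z51, z52, z53, z54, z55, z56, z57, z60, z61, z62, z63, z64, z65, z66, z67, z70, z71, z72, z73, z74, z75, z76, z77]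

set_option maxHeartbeats 4000000 in
lemma Zmat_mem {k : Type*} [Field k] (a d e u v : k) : Zmat a d e u v ∈ VSet k := by
  constructor
  · ext i j
    simp only [Matrix.mul_apply, Fin.sum_univ_eight, Matrix.neg_apply, Matrix.transpose_apply, Matrix.sub_apply]
    fin_cases i <;> fin_cases j <;> simp [Psi, Zmat] <;> ring
  · ext i j
    simp only [sMat, Matrix.mul_diagonal, Matrix.diagonal_mul, Matrix.neg_apply]
    fin_cases i <;> fin_cases j <;> simp [Zmat]

set_option maxHeartbeats 4000000 in
lemma Zmat_comm {k : Type*} [Field k] (a d e u v : k) :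
    Zmat a d e u v * Fint k = Fint k * Zmat a d e u v := by
  ext i j
  simp only [Matrix.mul_apply, Fin.sum_univ_eight, Matrix.neg_apply, Matrix.transpose_apply, Matrix.sub_apply]
  fin_cases i <;> fin_cases j <;> simp [Fint, Zmat] <;> ring

lemma Smat_eq {k : Type*} [Field k] (a d e u v : k) :
    emat k + Zmat a d e u v = Smat a d e u v := by
  ext i j
  fin_cases i <;> fin_cases j <;> simp [emat, Zmat, Smat]

lemma mem_Sigma {k : Type*} [Field k] (hch : 23 ≤ ringChar k)
    (f : Matrix (Fin 8) (Fin 8) k) (hf : f = (3 : k)⁻¹ • Fint k) (m : Matrix (Fin 8) (Fin 8) k) :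
    m ∈ SigmaSet k f ↔ ∃ a d e u v, m = Smat a d e u v := by
  have h3 : (3 : k) ≠ 0 := by exact_mod_cast nz hch 3 (by norm_num)
  subst hf
  constructor
  · rintro ⟨z, hz, hc, rfl⟩
    rw [Matrix.mul_smul, Matrix.smul_mul] at hc
    have hc' := smul_right_injective _ (inv_ne_zero h3) hc
    obtain ⟨a, d, e, u, v, rfl⟩ := z_eq hch z hz hc'
    exact ⟨a, d, e, u, v, Smat_eq a d e u v⟩
  · rintro ⟨a, d, e, u, v, rfl⟩
    refine ⟨Zmat a d e u v, Zmat_mem a d e u v, ?_, (Smat_eq a d e u v).symm⟩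
    rw [Matrix.mul_smul, Matrix.smul_mul, Zmat_comm]

/-- The even indices. -/
def ev : Fin 4 → Fin 8 := ![0,3,4,7]
/-- The odd indices. -/
def od : Fin 4 → Fin 8 := ![1,2,5,6]

section blocks

variable {R : Type*} [CommRing R]

def Mm (m : Matrix (Fin 8) (Fin 8) R) : Matrix (Fin 4) (Fin 4) R :=
  m.submatrix ev od * m.submatrix od ev
def T1 (m : Matrix (Fin 8) (Fin 8) R) : R := (Mm m).trace
def T2 (m : Matrix (Fin 8) (Fin 8) R) : R := (Mm m * Mm m).trace
def T3 (m : Matrix (Fin 8) (Fin 8) R) : R := (Mm m * Mm m * Mm m).trace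
def Q4 (m : Matrix (Fin 8) (Fin 8) R) : R := (m.submatrix ev od).det

lemma sub_mul_split (A B : Matrix (Fin 8) (Fin 8) R) (r c : Fin 4 → Fin 8) :
    (A * B).submatrix r c = A.submatrix r ev * B.submatrix ev c
      + A.submatrix r od * B.submatrix od c := by
  ext i j
  simp only [Matrix.submatrix_apply, Matrix.add_apply, Matrix.mul_apply, Fin.sum_univ_eight,
    Fin.sum_univ_four]
  simp [ev, od]
  ring

/-- The index splitting into even and odd. -/
def eo : Fin 4 ⊕ Fin 4 ≃ Fin 8 := Equiv.ofBijective (Sum.elim ev od) (by decide)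

lemma det_split (g : Matrix (Fin 8) (Fin 8) R) (h : g.submatrix od ev = 0) :
    g.det = (g.submatrix ev ev).det * (g.submatrix od od).det := by
  rw [← Matrix.det_submatrix_equiv_self eo g]
  have : g.submatrix eo eo = Matrix.fromBlocks (g.submatrix ev ev) (g.submatrix ev od) 0
      (g.submatrix od od) := by
    rw [← h]
    ext i j
    rcases i with i | i <;> rcases j with j | j <;> rfl
  rw [this, Matrix.det_fromBlocks_zero₂₁]

variable {S : Type*} [CommRing S] (φ : R →+* S)

lemma map_Mm (m : Matrix (Fin 8) (Fin 8) R) : (Mm m).map φ = Mm (m.map φ) := by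
  simp only [Mm, Matrix.map_mul, Matrix.submatrix_map]

lemma map_tr (m : Matrix (Fin 4) (Fin 4) R) : φ m.trace = (m.map φ).trace := by
  simp [Matrix.trace]

lemma map_T1 (m : Matrix (Fin 8) (Fin 8) R) : φ (T1 m) = T1 (m.map φ) := by
  simp only [T1, map_tr, map_Mm]
lemma map_T2 (m : Matrix (Fin 8) (Fin 8) R) : φ (T2 m) = T2 (m.map φ) := by
  simp only [T2, map_tr, Matrix.map_mul, map_Mm]
lemma map_T3 (m : Matrix (Fin 8) (Fin 8) R) : φ (T3 m) = T3 (m.map φ) := by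
  simp only [T3, map_tr, Matrix.map_mul, map_Mm]
lemma map_Q4 (m : Matrix (Fin 8) (Fin 8) R) : φ (Q4 m) = Q4 (m.map φ) := by
  simp only [Q4, RingHom.map_det, RingHom.mapMatrix_apply, Matrix.submatrix_map]

end blocks

lemma invariance {k : Type*} [Field k] (h2 : (2 : k) ≠ 0) (v g : Matrix (Fin 8) (Fin 8) k)
    (hg : gᵀ * Psi k * g = Psi k) (hdet : g.det = 1) (hs : g * sMat k = sMat k * g) :
    T1 (g * v * g⁻¹) = T1 v ∧ T2 (g * v * g⁻¹) = T2 v ∧ T3 (g * v * g⁻¹) = T3 v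
      ∧ Q4 (g * v * g⁻¹) = Q4 v := by
  obtain ⟨w, hw⟩ : ∃ w, w = g * v * g⁻¹ := ⟨_, rfl⟩
  rw [← hw]
  have hu : IsUnit g.det := by rw [hdet]; exact isUnit_one
  have hwg : w * g = g * v := by rw [hw, Matrix.nonsing_inv_mul_cancel_right _ _ hu]
  have hgs : ∀ i j, (![1,-1,-1,1,1,-1,-1,1] : Fin 8 → ℤ) i ≠ (![1,-1,-1,1,1,-1,-1,1] : Fin 8 → ℤ) j →
      g i j = 0 := by
    intro i j hij
    have h' := congrFun (congrFun hs i) j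
    simp only [sMat, Matrix.mul_diagonal, Matrix.diagonal_mul] at h'
    revert hij
    fin_cases i <;> fin_cases j <;> simp at h' ⊢ <;> grind
  have heo : g.submatrix ev od = 0 := by
    ext i j
    apply hgs
    revert i j
    decide
  have hoe : g.submatrix od ev = 0 := by
    ext i j
    apply hgs
    revert i j
    decide
  have hB : w.submatrix ev od * g.submatrix od od = g.submatrix ev ev * v.submatrix ev od := by
    have := congrArg (fun m => m.submatrix ev od) hwg
    simpa only [sub_mul_split, heo, hoe, Matrix.mul_zero, Matrix.zero_mul, zero_add, add_zero]
      using this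
  have hC : w.submatrix od ev * g.submatrix ev ev = g.submatrix od od * v.submatrix od ev := by
    have := congrArg (fun m => m.submatrix od ev) hwg
    simpa only [sub_mul_split, heo, hoe, Matrix.mul_zero, Matrix.zero_mul, zero_add, add_zero]
      using this
  have hd : (g.submatrix ev ev).det * (g.submatrix od od).det = 1 := by
    rw [← det_split g hoe, hdet]
  have hP : (g.submatrix ev ev)ᵀ * (Psi k).submatrix ev ev * g.submatrix ev ev
      = (Psi k).submatrix ev ev := by
    have := congrArg (fun m => m.submatrix ev ev) hg
    have hoe' : gᵀ.submatrix ev od = 0 := by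
      rw [← Matrix.transpose_submatrix, hoe, Matrix.transpose_zero]
    simpa only [sub_mul_split, heo, hoe, hoe', Matrix.mul_zero, Matrix.zero_mul, zero_add, add_zero,
      ← Matrix.transpose_submatrix] using this
  have hPP : (Psi k).submatrix ev ev * (Psi k).submatrix ev ev = 1 := by
    ext i j
    simp only [Matrix.mul_apply, Fin.sum_univ_four]
    fin_cases i <;> fin_cases j <;> simp [Psi, ev]
  have hPd : ((Psi k).submatrix ev ev).det ≠ 0 := by
    intro h
    have := congrArg Matrix.det hPP
    rw [Matrix.det_mul, h] at this
    simp at this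
  have hsq : (g.submatrix ev ev).det * (g.submatrix ev ev).det = 1 := by
    have := congrArg Matrix.det hP
    rw [Matrix.det_mul, Matrix.det_mul, Matrix.det_transpose] at this
    apply mul_left_cancel₀ hPd
    linear_combination this
  have hu1 : IsUnit (g.submatrix ev ev).det := IsUnit.of_mul_eq_one _ hd
  have hM : Mm w = g.submatrix ev ev * Mm v * (g.submatrix ev ev)⁻¹ := by
    rw [← Matrix.mul_nonsing_inv_cancel_right (g.submatrix ev ev) (Mm w) hu1]
    congr 1
    rw [Mm, Mm, Matrix.mul_assoc, hC, ← Matrix.mul_assoc, hB, Matrix.mul_assoc]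
  have hMM : ∀ X Y : Matrix (Fin 4) (Fin 4) k,
      (g.submatrix ev ev * X * (g.submatrix ev ev)⁻¹) * (g.submatrix ev ev * Y * (g.submatrix ev ev)⁻¹)
      = g.submatrix ev ev * (X * Y) * (g.submatrix ev ev)⁻¹ := by
    intro X Y
    simp only [Matrix.mul_assoc, Matrix.nonsing_inv_mul_cancel_left _ _ hu1]
  have htr : ∀ X : Matrix (Fin 4) (Fin 4) k,
      (g.submatrix ev ev * X * (g.submatrix ev ev)⁻¹).trace = X.trace := by
    intro X
    rw [Matrix.trace_mul_comm, Matrix.nonsing_inv_mul_cancel_left _ _ hu1]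
  refine ⟨?_, ?_, ?_, ?_⟩
  · rw [T1, T1, hM, htr]
  · rw [T2, T2, hM, hMM, htr]
  · rw [T3, T3, hM, hMM, hMM, htr]
  · have h := congrArg Matrix.det hB
    rw [Matrix.det_mul, Matrix.det_mul] at h
    rw [Q4, Q4]
    generalize (g.submatrix ev ev).det = α at *
    generalize (g.submatrix od od).det = β at *
    grind

section polys

open MvPolynomial

/-- The generic matrix. -/
def Xg (k : Type*) [Field k] : Matrix (Fin 8) (Fin 8) (MvPolynomial (Fin 8 × Fin 8) k) :=
  Matrix.of fun i j => X (i, j)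

variable (k : Type*) [Field k]

def p2P : MvPolynomial (Fin 8 × Fin 8) k := - T1 (Xg k)
def p4P : MvPolynomial (Fin 8 × Fin 8) k := C (2⁻¹) * (T1 (Xg k) ^ 2 - T2 (Xg k))
def q4P : MvPolynomial (Fin 8 × Fin 8) k := Q4 (Xg k)
def p6P : MvPolynomial (Fin 8 × Fin 8) k :=
  C (-6⁻¹) * (T1 (Xg k) ^ 3 - C 3 * (T1 (Xg k) * T2 (Xg k)) + C 2 * T3 (Xg k))
def yPP : MvPolynomial (Fin 8 × Fin 8) k := C (-5 * 9⁻¹) * (C 5 * X (3, 6) - X (1, 0))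
def xPP : MvPolynomial (Fin 8 × Fin 8) k := C 6 * (X (4, 5) + X (2, 7)) + C 5⁻¹ * yPP k

variable {k}

lemma hom_mul {a b : ℕ} {A B : Matrix (Fin 4) (Fin 4) (MvPolynomial (Fin 8 × Fin 8) k)}
    (hA : ∀ i j, (A i j).IsHomogeneous a) (hB : ∀ i j, (B i j).IsHomogeneous b) (i j : Fin 4) :
    ((A * B) i j).IsHomogeneous (a + b) := by
  rw [Matrix.mul_apply]
  exact IsHomogeneous.sum _ _ _ fun l _ => (hA i l).mul (hB l j)

lemma hom_tr {a : ℕ} {A : Matrix (Fin 4) (Fin 4) (MvPolynomial (Fin 8 × Fin 8) k)}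
    (hA : ∀ i j, (A i j).IsHomogeneous a) : A.trace.IsHomogeneous a :=
  IsHomogeneous.sum _ _ _ fun l _ => hA l l

lemma hom_M (i j : Fin 4) : (Mm (Xg k) i j).IsHomogeneous 2 :=
  hom_mul (a := 1) (b := 1) (fun _ _ => isHomogeneous_X _ _) (fun _ _ => isHomogeneous_X _ _) i j

lemma hom_T1 : (T1 (Xg k)).IsHomogeneous 2 := hom_tr hom_M
lemma hom_T2 : (T2 (Xg k)).IsHomogeneous 4 := hom_tr (hom_mul hom_M hom_M)
lemma hom_T3 : (T3 (Xg k)).IsHomogeneous 6 := hom_tr (hom_mul (hom_mul hom_M hom_M) hom_M)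

lemma hom_Q4 : (Q4 (Xg k)).IsHomogeneous 4 := by
  rw [Q4, Matrix.det_apply']
  refine IsHomogeneous.sum _ _ _ fun σ _ => ?_
  have h1 : (∏ i, (Xg k).submatrix ev od (σ i) i).IsHomogeneous (∑ _i : Fin 4, 1) :=
    IsHomogeneous.prod _ _ _ fun i _ => isHomogeneous_X _ _
  have h2 := h1.C_mul ((Equiv.Perm.sign σ : ℤ) : k)
  simpa using h2

lemma hom_p2 : (p2P k).IsHomogeneous 2 := hom_T1.neg
lemma hom_p4 : (p4P k).IsHomogeneous 4 := ((hom_T1.pow 2).sub hom_T2).C_mul _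
lemma hom_p6 : (p6P k).IsHomogeneous 6 :=
  (((hom_T1.pow 3).sub ((hom_T1.mul hom_T2).C_mul _)).add (hom_T3.C_mul _)).C_mul _

variable {k' : Type*} [Field k'] [Algebra k k']

lemma Xg_map (m : Matrix (Fin 8) (Fin 8) k') :
    (Xg k).map (aeval (fun q : Fin 8 × Fin 8 => m q.1 q.2) : _ →ₐ[k] k').toRingHom = m := by
  ext i j
  simp [Xg]

lemma ae_T1 (m : Matrix (Fin 8) (Fin 8) k') :
    aeval (fun q : Fin 8 × Fin 8 => m q.1 q.2) (T1 (Xg k)) = T1 m := by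
  have := map_T1 (aeval (fun q : Fin 8 × Fin 8 => m q.1 q.2) : _ →ₐ[k] k').toRingHom (Xg k)
  rwa [Xg_map] at this
lemma ae_T2 (m : Matrix (Fin 8) (Fin 8) k') :
    aeval (fun q : Fin 8 × Fin 8 => m q.1 q.2) (T2 (Xg k)) = T2 m := by
  have := map_T2 (aeval (fun q : Fin 8 × Fin 8 => m q.1 q.2) : _ →ₐ[k] k').toRingHom (Xg k)
  rwa [Xg_map] at this
lemma ae_T3 (m : Matrix (Fin 8) (Fin 8) k') :
    aeval (fun q : Fin 8 × Fin 8 => m q.1 q.2) (T3 (Xg k)) = T3 m := by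
  have := map_T3 (aeval (fun q : Fin 8 × Fin 8 => m q.1 q.2) : _ →ₐ[k] k').toRingHom (Xg k)
  rwa [Xg_map] at this
lemma ae_Q4 (m : Matrix (Fin 8) (Fin 8) k') :
    aeval (fun q : Fin 8 × Fin 8 => m q.1 q.2) (Q4 (Xg k)) = Q4 m := by
  have := map_Q4 (aeval (fun q : Fin 8 × Fin 8 => m q.1 q.2) : _ →ₐ[k] k').toRingHom (Xg k)
  rwa [Xg_map] at this

lemma pev_eq (P : MvPolynomial (Fin 8 × Fin 8) k) (m : Matrix (Fin 8) (Fin 8) k) :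
    pev P m = aeval (fun q : Fin 8 × Fin 8 => m q.1 q.2) P := by
  rfl

lemma Mm_S (a d e u v : k) : Mm (Smat a d e u v) = !![-24*a - 24*d, 0, 2, 1;
     60*a*u + 12*a*v + 60*d*u + 12*d*v + 108*e*u + 108*e*v, -24*a - 24*d, -u + v + 432*a*a + 864*a*d + 432*a*e + 432*d*d - 1728*d*e - 432*e*e, -2*u - v + 216*a*a + 432*a*d - 216*a*e + 216*d*d + 864*d*e - 216*e*e;
     -2*u - v + 216*a*a + 432*a*d - 216*a*e + 216*d*d + 864*d*e - 216*e*e, 1, -36*a + 24*d, -18*a - 48*d + 24*e;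
     -u + v + 432*a*a + 864*a*d + 432*a*e + 432*d*d - 1728*d*e - 432*e*e, 2, -72*a - 192*d - 96*e, -36*a + 24*d] := by
  ext i j
  simp only [Mm, Matrix.mul_apply, Fin.sum_univ_four, Matrix.submatrix_apply]
  fin_cases i <;> fin_cases j <;> simp [Smat, ev, od] <;> ring

lemma T1_S (a d e u v : k) : T1 (Smat a d e u v) = -(120*a) := by
  simp only [T1, Mm_S, Matrix.trace, Matrix.diag, Fin.sum_univ_four]
  simp
  ring

lemma T2_S (a d e u v : k) : T2 (Smat a d e u v) = (120*a) ^ 2 - 2 * (10*u + 2*v + 2304*a*a - 9792*a*d - 12096*d*d + 4032*e*e) := by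
  simp only [T2, Mm_S, Matrix.trace, Matrix.diag, Fin.sum_univ_four, Matrix.mul_apply]
  simp
  ring

lemma T3_S (a d e u v : k) : T3 (Smat a d e u v) =
    -(120*a) ^ 3 + 3 * (120*a) * (10*u + 2*v + 2304*a*a - 9792*a*d - 12096*d*d + 4032*e*e) - 3 * (-1200*d*u - 240*d*v - 720*e*u - 720*e*v - 276480*a*a*d - 552960*a*d*d + 69120*a*e*e - 276480*d*d*d + 276480*d*e*e) := by
  simp only [T3, Mm_S, Matrix.trace, Matrix.diag, Fin.sum_univ_four, Matrix.mul_apply]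
  simp
  ring

lemma Q4_S (a d e u v : k) : Q4 (Smat a d e u v) = -3*u - 3*v + 288*a*e - 4032*d*e := by
  rw [Q4, Matrix.det_succ_row_zero]
  simp only [Fin.sum_univ_four, Matrix.det_fin_three, Matrix.submatrix_apply]
  simp [Smat, ev, od, Fin.succAbove]
  ring

lemma pev_p2 (a d e u v : k) : pev (p2P k) (Smat a d e u v) = 120*a := by
  rw [pev_eq, p2P, map_neg, ae_T1, T1_S, neg_neg]

lemma pev_p4 (h2 : (2 : k) ≠ 0) (a d e u v : k) : pev (p4P k) (Smat a d e u v) = 10*u + 2*v + 2304*a*a - 9792*a*d - 12096*d*d + 4032*e*e := by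
  rw [pev_eq, p4P, map_mul, map_sub, map_pow, ae_T1, ae_T2, T1_S, T2_S, aeval_C, Algebra.algebraMap_self_apply]
  apply mul_left_cancel₀ h2
  rw [mul_inv_cancel_left₀ h2]
  ring

lemma pev_q4 (a d e u v : k) : pev (q4P k) (Smat a d e u v) = -3*u - 3*v + 288*a*e - 4032*d*e := by
  rw [pev_eq, q4P, ae_Q4, Q4_S]

lemma pev_p6 (h6 : (6 : k) ≠ 0) (a d e u v : k) : pev (p6P k) (Smat a d e u v) = -1200*d*u - 240*d*v - 720*e*u - 720*e*v - 276480*a*a*d - 552960*a*d*d + 69120*a*e*e - 276480*d*d*d + 276480*d*e*e := by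
  simp only [pev_eq, p6P, map_mul, map_sub, map_add, map_pow, ae_T1, ae_T2, ae_T3, T1_S, T2_S, T3_S,
    aeval_C, Algebra.algebraMap_self_apply]
  apply mul_left_cancel₀ h6
  rw [← mul_assoc, mul_neg, mul_inv_cancel₀ h6]
  ring

lemma pev_y (h9 : (9 : k) ≠ 0) (a d e u v : k) : pev (yPP k) (Smat a d e u v) = 120 * e := by
  simp [pev, yPP, Smat]
  field_simp
  ring

lemma pev_x (h5 : (5 : k) ≠ 0) (h9 : (9 : k) ≠ 0) (a d e u v : k) :
    pev (xPP k) (Smat a d e u v) = 120 * d := by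
  have hy := pev_y h9 a d e u v
  rw [pev] at hy
  rw [pev, xPP, map_add, map_mul (eval _) (C 5⁻¹), hy]
  simp [Smat]
  field_simp
  ring

/-- The inverse on the level of parameters, over a ring with chosen inverses of `24` and `120`. -/
def invS {R : Type*} [CommRing R] (c24 c120 : R) (w : Fin 5 → R) : Matrix (Fin 8) (Fin 8) R :=
  let a := c120 * w 0
  let d := c120 * w 3
  let e := c120 * w 4
  let r := w 1 - (2304*a*a - 9792*a*d - 12096*d*d + 4032*e*e)
  let q := w 2 - (288*a*e - 4032*d*e)
  Smat a d e (c24 * (3 * r + 2 * q)) (c24 * (-3 * r - 10 * q))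

lemma map_Smat {R S : Type*} [CommRing R] [CommRing S] (φ : R →+* S) (a d e u v : R) (i j : Fin 8) :
    φ (Smat a d e u v i j) = Smat (φ a) (φ d) (φ e) (φ u) (φ v) i j := by
  fin_cases i <;> fin_cases j <;> simp [Smat, map_ofNat]

lemma map_invS {R S : Type*} [CommRing R] [CommRing S] (φ : R →+* S) (c24 c120 : R)
    (w : Fin 5 → R) (i j : Fin 8) :
    φ (invS c24 c120 w i j) = invS (φ c24) (φ c120) (fun l => φ (w l)) i j := by
  simp only [invS, map_Smat, map_mul, map_add, map_sub, map_neg, map_ofNat]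

end polys

/-- there are invariant polynomial functions `p₂, p₄, q₄, p₆` on `V`,
homogeneous of degrees 2, 4, 4, 6, and polynomial functions `x, y` on `Σ`, such that
`y(xy + 2q₄) = x³ + p₂x² + p₄x + p₆` holds on `Σ` and
`σ ↦ (p₂(σ), p₄(σ), q₄(σ), x(σ), y(σ))` is an isomorphism of affine varieties `Σ ≅ k⁵`
(a polynomial map with polynomial inverse). -/
theorem stmt12 (k : Type*) [Field k] (hch : 23 ≤ ringChar k)
    (f : Matrix (Fin 8) (Fin 8) k) (hfV : f ∈ VSet k)
    (hfwt : ∀ t : k, t ≠ 0 → lam k t * f * (lam k t)⁻¹ = t⁻¹ • f)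
    (hef : emat k * f - f * emat k = Matrix.diagonal ![4,2,-2,-4,0,2,-2,0]) :
    ∃ p2 p4 q4 p6 xP yP : MvPolynomial (Fin 8 × Fin 8) k,
      p2.IsHomogeneous 2 ∧ p4.IsHomogeneous 4 ∧ q4.IsHomogeneous 4 ∧ p6.IsHomogeneous 6
      -- invariance of p₂, p₄, q₄, p₆ over every field extension k'/k
      ∧ (∀ P ∈ ({p2, p4, q4, p6} : Set (MvPolynomial (Fin 8 × Fin 8) k)),
          ∀ (k' : Type*) [Field k'] [Algebra k k'],
            ∀ v g : Matrix (Fin 8) (Fin 8) k',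
              v ∈ VSet k' →
              gᵀ * Psi k' * g = Psi k' →
              g.det = 1 →
              g * sMat k' = sMat k' * g →
              MvPolynomial.aeval (fun q : Fin 8 × Fin 8 => (g * v * g⁻¹) q.1 q.2) P
                = MvPolynomial.aeval (fun q : Fin 8 × Fin 8 => v q.1 q.2) P)
      -- (i) the Weierstrass-type relation holds at every point of Σ
      ∧ (∀ v ∈ SigmaSet k f,
          pev yP v * (pev xP v * pev yP v + 2 * pev q4 v)
            = pev xP v ^ 3 + pev p2 v * pev xP v ^ 2 + pev p4 v * pev xP v + pev p6 v)
      -- (ii) σ ↦ (p₂(σ), p₄(σ), q₄(σ), x(σ), y(σ)) is an isomorphism Σ ≅ 𝔸⁵ of affine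
      -- varieties, i.e. it has a polynomial inverse
      ∧ (∃ inv : Fin 8 × Fin 8 → MvPolynomial (Fin 5) k,
          (∀ w : Fin 5 → k,
            (Matrix.of fun i j => MvPolynomial.eval w (inv (i, j))) ∈ SigmaSet k f)
          ∧ (∀ v ∈ SigmaSet k f,
              (Matrix.of fun i j =>
                MvPolynomial.eval
                  (![pev p2 v, pev p4 v, pev q4 v, pev xP v, pev yP v]) (inv (i, j))) = v)
          ∧ (∀ w : Fin 5 → k, ∀ M : Matrix (Fin 8) (Fin 8) k,
              M = (Matrix.of fun i j => MvPolynomial.eval w (inv (i, j))) →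
              ![pev p2 M, pev p4 M, pev q4 M, pev xP M, pev yP M] = w)) := by
  have nz' : ∀ n : ℕ, n ∣ 210 ^ 6 → (n : k) ≠ 0 := nz hch
  have h2 : (2 : k) ≠ 0 := by exact_mod_cast nz' 2 (by norm_num)
  have h5 : (5 : k) ≠ 0 := by exact_mod_cast nz' 5 (by norm_num)
  have h6 : (6 : k) ≠ 0 := by exact_mod_cast nz' 6 (by norm_num)
  have h9 : (9 : k) ≠ 0 := by exact_mod_cast nz' 9 (by norm_num)
  have h24 : (24 : k) ≠ 0 := by exact_mod_cast nz' 24 (by norm_num)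
  have h120 : (120 : k) ≠ 0 := by exact_mod_cast nz' 120 (by norm_num)
  have hf := f_eq hch f hfV hfwt hef
  have hS := mem_Sigma hch f hf
  have hinv : ∀ w : Fin 5 → k, (Matrix.of fun i j => MvPolynomial.eval w
      (invS (MvPolynomial.C 24⁻¹) (MvPolynomial.C 120⁻¹) MvPolynomial.X (i, j).1 (i, j).2))
      = invS 24⁻¹ 120⁻¹ w := by
    intro w
    ext i j
    rw [Matrix.of_apply, map_invS]
    simp
  refine ⟨p2P k, p4P k, q4P k, p6P k, xPP k, yPP k, hom_p2, hom_p4, hom_Q4, hom_p6, ?_, ?_,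
    fun q => invS (MvPolynomial.C 24⁻¹) (MvPolynomial.C 120⁻¹) MvPolynomial.X q.1 q.2, ?_, ?_, ?_⟩
  · intro P hP k' _ _ v g _ hg hdet hs
    have h2' : (2 : k') ≠ 0 := by
      have := (map_ne_zero (algebraMap k k')).2 h2
      rwa [map_ofNat] at this
    obtain ⟨i1, i2, i3, i4⟩ := invariance h2' v g hg hdet hs
    rcases hP with rfl | rfl | rfl | rfl
    · simp only [p2P, map_neg, ae_T1, i1]
    · simp only [p4P, map_mul, map_sub, map_pow, ae_T1, ae_T2, i1, i2, MvPolynomial.aeval_C]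
    · simp only [q4P, ae_Q4, i4]
    · simp only [p6P, map_mul, map_sub, map_add, map_pow, ae_T1, ae_T2, ae_T3, i1, i2, i3,
        MvPolynomial.aeval_C]
  · intro m hm
    obtain ⟨a, d, e, u, v, rfl⟩ := (hS m).1 hm
    rw [pev_p2, pev_p4 h2, pev_q4, pev_p6 h6, pev_x h5 h9, pev_y h9]
    ring
  · intro w
    rw [hinv, hS]
    exact ⟨_, _, _, _, _, rfl⟩
  · intro m hm
    obtain ⟨a, d, e, u, v, rfl⟩ := (hS m).1 hm
    rw [hinv, pev_p2, pev_p4 h2, pev_q4, pev_x h5 h9, pev_y h9]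
    simp only [invS, Matrix.cons_val, inv_mul_cancel_left₀ h120]
    congr 1
    · apply mul_left_cancel₀ h24
      rw [mul_inv_cancel_left₀ h24]
      ring
    · apply mul_left_cancel₀ h24
      rw [mul_inv_cancel_left₀ h24]
      ring
  · intro w M hM
    rw [hinv] at hM
    rw [hM, invS]
    simp only [pev_p2, pev_p4 h2, pev_q4, pev_x h5 h9, pev_y h9, mul_inv_cancel_left₀ h120]
    have hc : (24 : k) * 24⁻¹ = 1 := mul_inv_cancel₀ h24
    generalize (24 : k)⁻¹ = c at *
    ext i
    fin_cases i
    · simp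
    · simp only [Matrix.cons_val, Fin.mk_one]
      linear_combination (w 1 - (2304*(120⁻¹*w 0)*(120⁻¹*w 0) - 9792*(120⁻¹*w 0)*(120⁻¹*w 3) - 12096*(120⁻¹*w 3)*(120⁻¹*w 3) + 4032*(120⁻¹*w 4)*(120⁻¹*w 4))) * hc
    · simp only [Matrix.cons_val, Fin.reduceFinMk]
      linear_combination (w 2 - (288*(120⁻¹*w 0)*(120⁻¹*w 4) - 4032*(120⁻¹*w 3)*(120⁻¹*w 4))) * hc
    · simp
    · simp

end
end
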